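/- For all real x ≥ 0, the first derivative of L(x) = log(Q(x)) satisfies L'(x) ≤ −(2/π)·x − √(2/π); equivalently, the hazard rate φ(x)/Q(x) of the standard normal distribution satisfies φ(x)/Q(x) ≥ (2/π)·x + √(2/π) for x ≥ 0. -/

import Mathlib

open Real MeasureTheory

/-- The Gaussian Q-function: tail probability of a standard normal. -/
noncomputable def gaussQ (x : ℝ) : ℝ :=
  (1 / Real.sqrt (2 * Real.pi)) * ∫ u in Set.Ioi x, Real.exp (-u ^ 2 / 2)

/-- The standard normal density. -/
noncomputable def gaussPhi (x : ℝ) : ℝ :=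
  Real.exp (-x ^ 2 / 2) / Real.sqrt (2 * Real.pi)

lemma aux_integrable : Integrable (fun u : ℝ => Real.exp (-u ^ 2 / 2)) := by
  have h := integrable_exp_neg_mul_sq (b := 1 / 2) (by norm_num)
  refine h.congr (Filter.Eventually.of_forall fun u => ?_)
  simp only
  congr 1
  ring

lemma aux_total : ∫ u in Set.Ioi (0 : ℝ), Real.exp (-u ^ 2 / 2) = Real.sqrt (2 * Real.pi) / 2 := by
  have h := integral_gaussian_Ioi (1 / 2)
  have e : ∀ u : ℝ, Real.exp (-u ^ 2 / 2) = Real.exp (-(1 / 2) * u ^ 2) := fun u => by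
    congr 1
    ring
  simp only [e]
  rw [h]
  congr 2
  ring

lemma aux_split (x : ℝ) : ∫ u in Set.Ioi x, Real.exp (-u ^ 2 / 2) =
    Real.sqrt (2 * Real.pi) / 2 - ∫ u in (0 : ℝ)..x, Real.exp (-u ^ 2 / 2) := by
  have h := intervalIntegral.integral_Ioi_sub_Ioi' (a := (0 : ℝ)) (b := x)
    (aux_integrable.integrableOn) (aux_integrable.integrableOn) (μ := volume)
  rw [aux_total] at h
  linarith

lemma aux_cont : Continuous (fun u : ℝ => Real.exp (-u ^ 2 / 2)) := by fun_prop

lemma aux_deriv (x : ℝ) : HasDerivAt (fun x : ℝ => ∫ u in Set.Ioi x, Real.exp (-u ^ 2 / 2))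
    (-Real.exp (-x ^ 2 / 2)) x := by
  have h := (aux_cont.integral_hasStrictDerivAt 0 x).hasDerivAt.const_sub
    (Real.sqrt (2 * Real.pi) / 2)
  exact h.congr_of_eventuallyEq (Filter.Eventually.of_forall fun y => aux_split y)

lemma aux_tendsto : Filter.Tendsto (fun x : ℝ => ∫ u in Set.Ioi x, Real.exp (-u ^ 2 / 2))
    Filter.atTop (nhds 0) := by
  have h := intervalIntegral_tendsto_integral_Ioi (0 : ℝ)
    (aux_integrable.integrableOn) Filter.tendsto_id (μ := volume)
  have h2 := h.const_sub (Real.sqrt (2 * Real.pi) / 2)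
  rw [aux_total, sub_self] at h2
  exact h2.congr fun y => (aux_split y).symm

lemma aux_pos (x : ℝ) : 0 < ∫ u in Set.Ioi x, Real.exp (-u ^ 2 / 2) := by
  have : NeZero (volume.restrict (Set.Ioi x)) := ⟨by simp⟩
  exact integral_exp_pos aux_integrable.integrableOn

lemma aux_E (x : ℝ) : HasDerivAt (fun x : ℝ => Real.exp (-x ^ 2 / 2))
    (-x * Real.exp (-x ^ 2 / 2)) x := by
  have h1 : HasDerivAt (fun x : ℝ => -x ^ 2 / 2) (-x) x := by
    refine ((hasDerivAt_pow 2 x).neg.div_const 2).congr_deriv ?_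
    norm_num
    ring
  exact h1.exp.congr_deriv (mul_comm _ _)

lemma aux_main (a b : ℝ) (hb : 0 < b) (hab : b ^ 2 = a) (ha : 1 / 2 < a) (ha1 : a < 1)
    (h0 : 1 / b = Real.sqrt (2 * Real.pi) / 2) (x : ℝ) (hx : 0 ≤ x) :
    (a * x + b) * ∫ u in Set.Ioi x, Real.exp (-u ^ 2 / 2) ≤ Real.exp (-x ^ 2 / 2) := by
  set g : ℝ → ℝ := fun x => Real.exp (-x ^ 2 / 2) / (a * x + b) -
    ∫ u in Set.Ioi x, Real.exp (-u ^ 2 / 2) with hg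
  have hp : ∀ y : ℝ, 0 ≤ y → 0 < a * y + b := fun y hy => by positivity
  have hd : ∀ y : ℝ, 0 ≤ y → HasDerivAt g (Real.exp (-y ^ 2 / 2) / (a * y + b) ^ 2 *
      (y * (b * (2 * a - 1) - a * (1 - a) * y))) y := fun y hy => by
    have hl : HasDerivAt (fun y : ℝ => a * y + b) a y := by
      simpa using ((hasDerivAt_id y).const_mul a).add_const b
    have h := ((aux_E y).div hl (hp y hy).ne').sub (aux_deriv y)
    refine h.congr_deriv ?_
    have := (hp y hy).ne'
    field_simp
    subst hab
    ring
  have hA : 0 < a * (1 - a) := mul_pos (by linarith) (by linarith)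
  set c := b * (2 * a - 1) / (a * (1 - a)) with hc
  have hcA : a * (1 - a) * c = b * (2 * a - 1) := by
    rw [hc, mul_div_cancel₀ _ hA.ne']
  have hc0 : 0 ≤ c := div_nonneg (mul_nonneg hb.le (by linarith)) hA.le
  have hg0 : g 0 = 0 := by
    simp only [hg]
    rw [aux_total, ← h0]
    simp
  have hgx : 0 ≤ g x := by
    rcases le_total x c with hxc | hxc
    · have hm : MonotoneOn g (Set.Icc 0 c) := by
        apply monotoneOn_of_deriv_nonneg (convex_Icc 0 c)
        · exact fun y hy => (hd y hy.1).continuousAt.continuousWithinAt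
        · intro y hy
          rw [interior_Icc] at hy
          exact (hd y hy.1.le).differentiableAt.differentiableWithinAt
        · intro y hy
          rw [interior_Icc] at hy
          rw [(hd y hy.1.le).deriv]
          have := mul_le_mul_of_nonneg_left hy.2.le hA.le
          exact mul_nonneg (by positivity) (mul_nonneg hy.1.le (by linarith))
      have := hm ⟨le_rfl, hc0⟩ ⟨hx, hxc⟩ hx
      linarith
    · have hm : AntitoneOn g (Set.Ici c) := by
        apply antitoneOn_of_deriv_nonpos (convex_Ici c)
        · exact fun y hy => (hd y (hc0.trans hy)).continuousAt.continuousWithinAt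
        · intro y hy
          rw [interior_Ici] at hy
          exact (hd y (hc0.trans (le_of_lt hy))).differentiableAt.differentiableWithinAt
        · intro y hy
          rw [interior_Ici] at hy
          have hy0 := hc0.trans (le_of_lt hy)
          rw [(hd y hy0).deriv]
          have := mul_le_mul_of_nonneg_left (le_of_lt hy) hA.le
          exact mul_nonpos_of_nonneg_of_nonpos (by positivity)
            (mul_nonpos_of_nonneg_of_nonpos hy0 (by linarith))
      have ht : Filter.Tendsto (fun y : ℝ => - ∫ u in Set.Ioi y, Real.exp (-u ^ 2 / 2))
          Filter.atTop (nhds 0) := by simpa using aux_tendsto.neg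
      refine le_of_tendsto ht ?_
      filter_upwards [Filter.eventually_ge_atTop x] with y hy
      have h1 := hm hxc (hxc.trans hy) hy
      have h2 : 0 ≤ Real.exp (-y ^ 2 / 2) / (a * y + b) :=
        div_nonneg (Real.exp_pos _).le (hp y (hx.trans hy)).le
      have h3 : g y = Real.exp (-y ^ 2 / 2) / (a * y + b) -
        ∫ u in Set.Ioi y, Real.exp (-u ^ 2 / 2) := rfl
      linarith
  have h4 : ∫ u in Set.Ioi x, Real.exp (-u ^ 2 / 2) ≤ Real.exp (-x ^ 2 / 2) / (a * x + b) := by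
    simp only [hg] at hgx
    linarith
  rw [le_div_iff₀ (hp x hx)] at h4
  linarith

theorem deriv_log_gaussQ_le (x : ℝ) (hx : 0 ≤ x) :
    deriv (fun y : ℝ => Real.log (gaussQ y)) x ≤ -(2 / Real.pi) * x - Real.sqrt (2 / Real.pi) ∧
    gaussPhi x / gaussQ x ≥ (2 / Real.pi) * x + Real.sqrt (2 / Real.pi) := by
  have hpi := Real.pi_pos
  have hs : 0 < Real.sqrt (2 * Real.pi) := Real.sqrt_pos.mpr (by positivity)
  have hI := aux_pos x
  have hQ : 0 < gaussQ x := by unfold gaussQ; positivity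
  have hD : HasDerivAt gaussQ (-gaussPhi x) x := by
    have h := (aux_deriv x).const_mul (1 / Real.sqrt (2 * Real.pi))
    refine h.congr_deriv ?_
    unfold gaussPhi
    ring
  have h0 : 1 / Real.sqrt (2 / Real.pi) = Real.sqrt (2 * Real.pi) / 2 := by
    have hb : 0 < Real.sqrt (2 / Real.pi) := Real.sqrt_pos.mpr (by positivity)
    have : Real.sqrt (2 / Real.pi) * Real.sqrt (2 * Real.pi) = 2 := by
      rw [← Real.sqrt_mul (by positivity)]
      rw [show 2 / Real.pi * (2 * Real.pi) = 2 ^ 2 by field_simp]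
      exact Real.sqrt_sq (by norm_num)
    field_simp
    linarith
  have hm := aux_main (2 / Real.pi) (Real.sqrt (2 / Real.pi)) (Real.sqrt_pos.mpr (by positivity))
    (Real.sq_sqrt (by positivity))
    (by rw [div_lt_div_iff₀ (by norm_num) hpi]; linarith [Real.pi_lt_four])
    (by rw [div_lt_one hpi]; linarith [Real.pi_gt_three]) h0 x hx
  have h2 : gaussPhi x / gaussQ x ≥ (2 / Real.pi) * x + Real.sqrt (2 / Real.pi) := by
    rw [ge_iff_le, le_div_iff₀ hQ]
    unfold gaussQ gaussPhi
    rw [le_div_iff₀ hs]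
    refine le_of_eq_of_le ?_ hm
    field_simp
  refine ⟨?_, h2⟩
  rw [(hD.log hQ.ne').deriv, neg_div]
  linarith
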